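/- Every complex antisymmetric n×n matrix M (Mᵀ = -M) can be brought by a unitary congruence to a direct sum of 2×2 blocks [[0, λⱼ],[-λⱼ, 0]] with λⱼ ≥ 0 real, padded by zeros if n is odd: there exists a unitary U with U M Uᵀ in this block form (Hua–Youla decomposition). -/

import Mathlib

open Matrix

open scoped ComplexOrder in
/-- A nonzero complex antisymmetric matrix `M` admits an orthonormal pair `u, v` with
`M v = λ ū` and `M u = -λ v̄` for some real `λ ≥ 0`. -/
lemma Matrix.exists_orthonormal_pair_of_transpose_eq_neg {ι : Type*} [Fintype ι] [DecidableEq ι]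
    (M : Matrix ι ι ℂ) (hM : Mᵀ = -M) (h0 : M ≠ 0) :
    ∃ (c : ℝ) (u v : ι → ℂ), 0 ≤ c ∧ u ⬝ᵥ star u = 1 ∧ v ⬝ᵥ star v = 1 ∧ u ⬝ᵥ star v = 0 ∧
      M *ᵥ v = (c : ℂ) • star u ∧ M *ᵥ u = -((c : ℂ) • star v) := by
  have hH : (Mᴴ * M).IsHermitian := isHermitian_conjTranspose_mul_self M
  obtain ⟨i, hi⟩ : ∃ i, hH.eigenvalues i ≠ 0 := by
    by_contra! h
    exact h0 (conjTranspose_mul_self_eq_zero.1 (hH.eigenvalues_eq_zero_iff.1 (funext h)))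
  have hnn : 0 ≤ hH.eigenvalues i := (posSemidef_conjTranspose_mul_self M).eigenvalues_nonneg i
  set x : ι → ℂ := ⇑(hH.eigenvectorBasis i) with hx
  set c : ℝ := √(hH.eigenvalues i)
  have hcc : c * c = hH.eigenvalues i := Real.mul_self_sqrt hnn
  have hc0 : (c : ℂ) ≠ 0 := by
    intro h
    apply hi
    rw [← hcc, Complex.ofReal_eq_zero.1 h, zero_mul]
  have heig : Mᴴ *ᵥ (M *ᵥ x) = ((c : ℂ) * c) • x := by
    rw [mulVec_mulVec, hx, hH.mulVec_eigenvectorBasis i, ← hcc, ← Complex.ofReal_mul]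
    ext a
    simp
  have hxx : x ⬝ᵥ star x = 1 := by
    have h := (orthonormal_iff_ite.1 hH.eigenvectorBasis.orthonormal) i i
    rw [if_pos rfl, EuclideanSpace.inner_eq_star_dotProduct] at h
    exact h
  have hstar : M *ᵥ star (M *ᵥ x) = -(((c : ℂ) * c) • star x) := by
    have h := congrArg star heig
    rw [star_mulVec, conjTranspose_conjTranspose, ← mulVec_transpose, hM, neg_mulVec] at h
    rw [← neg_neg (M *ᵥ star (M *ᵥ x)), h, star_smul]
    simp
  refine ⟨c, (c : ℂ)⁻¹ • star (M *ᵥ x), x, Real.sqrt_nonneg _, ?_, hxx, ?_, ?_, ?_⟩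
  · have h : star (M *ᵥ x) ⬝ᵥ (M *ᵥ x) = (c : ℂ) * c := by
      rw [star_mulVec, ← dotProduct_mulVec, heig, dotProduct_smul, dotProduct_comm, hxx]
      simp
    rw [star_smul, star_star, smul_dotProduct, dotProduct_smul, h]
    simp
    field_simp
  · have h : x ⬝ᵥ (M *ᵥ x) = 0 := by
      have h1 : x ⬝ᵥ (M *ᵥ x) = -(x ⬝ᵥ (M *ᵥ x)) := by
        conv_lhs => rw [dotProduct_mulVec, ← mulVec_transpose, hM, neg_mulVec, neg_dotProduct,
          dotProduct_comm]
      exact self_eq_neg.1 h1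
    rw [smul_dotProduct, star_dotProduct_star, h]
    simp
  · rw [star_smul, star_star, smul_smul]
    simp [hc0]
  · rw [mulVec_smul, hstar, smul_neg, smul_smul, inv_mul_cancel_left₀ hc0]

/-- Every pair of orthonormal vectors consists of the first two rows of a unitary matrix. -/
lemma Matrix.exists_mul_conjTranspose_eq_one_of_orthonormal_pair {k : ℕ} (u v : Fin (2 + k) → ℂ)
    (hu : u ⬝ᵥ star u = 1) (hv : v ⬝ᵥ star v = 1) (huv : u ⬝ᵥ star v = 0) :
    ∃ V : Matrix (Fin 2 ⊕ Fin k) (Fin (2 + k)) ℂ,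
      V * Vᴴ = 1 ∧ V (Sum.inl 0) = u ∧ V (Sum.inl 1) = v := by
  have hvu : v ⬝ᵥ star u = 0 := by
    have h := congrArg star huv
    rwa [← star_dotProduct_star, star_star, star_zero] at h
  let w : Fin 2 ⊕ Fin k → EuclideanSpace ℂ (Fin (2 + k)) :=
    Sum.elim ![WithLp.toLp 2 u, WithLp.toLp 2 v] 0
  have hw : Orthonormal ℂ ((Set.range Sum.inl).domRestrict w) := by
    rw [orthonormal_iff_ite]
    rintro ⟨_, i, rfl⟩ ⟨_, j, rfl⟩
    change inner ℂ (w (Sum.inl i)) (w (Sum.inl j)) = _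
    rw [EuclideanSpace.inner_eq_star_dotProduct]
    fin_cases i <;> fin_cases j <;> simp [w, hu, hv, huv, hvu]
  obtain ⟨b, hb⟩ := hw.exists_orthonormalBasis_extension_of_card_eq (by simp)
  refine ⟨fun i a => b i a, ?_, ?_, ?_⟩
  · ext i j
    have h := orthonormal_iff_ite.1 b.orthonormal j i
    rw [EuclideanSpace.inner_eq_star_dotProduct] at h
    rw [one_apply, ← (if_congr (eq_comm (a := j) (b := i)) rfl rfl), ← h]
    rfl
  · ext a
    simp [hb (Sum.inl 0) ⟨0, rfl⟩, w]
  · ext a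
    simp [hb (Sum.inl 1) ⟨1, rfl⟩, w]

/-- Hua–Youla decomposition: every complex antisymmetric matrix can be
    brought by a unitary congruence M ↦ U M Uᵀ to a direct sum of 2×2 blocks
    [[0, λⱼ],[-λⱼ, 0]] with λⱼ ≥ 0 real, padded by zeros if n is odd. -/
theorem stmt7 (n : ℕ) (M : Matrix (Fin n) (Fin n) ℂ) (hM : Mᵀ = -M) :
    ∃ (U : Matrix (Fin n) (Fin n) ℂ) (l : ℕ → ℝ),
      Uᴴ * U = 1 ∧ (∀ j, 0 ≤ l j) ∧
      ∀ i j : Fin n,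
        (U * M * Uᵀ) i j =
          if i.val % 2 = 0 ∧ j.val = i.val + 1 then (l (i.val / 2) : ℂ)
          else if j.val % 2 = 0 ∧ i.val = j.val + 1 then -(l (j.val / 2) : ℂ)
          else 0 := by
  induction n using Nat.strong_induction_on with
  | _ n ih =>
  by_cases h0 : M = 0
  · exact ⟨1, 0, by simp, by simp, by simp [h0]⟩
  obtain ⟨k, rfl⟩ : ∃ k, n = 2 + k := by
    refine Nat.exists_eq_add_of_le (not_lt.1 fun hn => h0 ?_)
    ext i j
    have hij : i = j := by omega
    have h := congrFun (congrFun hM i) i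
    subst hij
    exact self_eq_neg.1 h
  obtain ⟨c, u, v, hc, hu, hv, huv, hMv, hMu⟩ :=
    M.exists_orthonormal_pair_of_transpose_eq_neg hM h0
  obtain ⟨V, hV, hVu, hVv⟩ :=
    exists_mul_conjTranspose_eq_one_of_orthonormal_pair u v hu hv huv
  have happ : ∀ i j, (V * M * Vᵀ) i j = V i ⬝ᵥ (M *ᵥ V j) := by
    intro i j
    rw [Matrix.mul_assoc]
    rfl
  have horth : ∀ i j, V i ⬝ᵥ star (V j) = if i = j then 1 else 0 := fun i j => by
    rw [← one_apply, ← hV]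
    rfl
  have hN : (V * M * Vᵀ)ᵀ = -(V * M * Vᵀ) := by
    simp [transpose_mul, hM, Matrix.mul_assoc]
  have h0c : ∀ i, (V * M * Vᵀ) i (Sum.inl 0) = if i = Sum.inl 1 then -(c : ℂ) else 0 := by
    intro i
    rw [happ, hVu, hMu, ← hVv, dotProduct_neg, dotProduct_smul, horth]
    split_ifs <;> simp
  have h1c : ∀ i, (V * M * Vᵀ) i (Sum.inl 1) = if i = Sum.inl 0 then (c : ℂ) else 0 := by
    intro i
    rw [happ, hVv, hMv, ← hVu, dotProduct_smul, horth]
    split_ifs <;> simp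
  have hblock : V * M * Vᵀ =
      fromBlocks !![0, (c : ℂ); -c, 0] 0 0 (V * M * Vᵀ).toBlocks₂₂ := by
    have hcol : ∀ (i : Fin k) (j : Fin 2), (V * M * Vᵀ) (Sum.inr i) (Sum.inl j) = 0 := by
      intro i j
      fin_cases j
      · simpa using h0c (Sum.inr i)
      · simpa using h1c (Sum.inr i)
    ext (i | i) (j | j)
    · fin_cases i <;> fin_cases j
      · simpa using h0c (Sum.inl 0)
      · simpa using h1c (Sum.inl 0)
      · simpa using h0c (Sum.inl 1)
      · simpa using h1c (Sum.inl 1)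
    · have h := congrFun (congrFun hN (Sum.inr j)) (Sum.inl i)
      rw [neg_apply, hcol, neg_zero] at h
      exact h
    · exact hcol i j
    · rfl
  obtain ⟨U, l, hU, hl, hUl⟩ := ih k (by omega) (V * M * Vᵀ).toBlocks₂₂ (by
    ext i j
    exact congrFun (congrFun hN (Sum.inr i)) (Sum.inr j))
  obtain ⟨D, hD⟩ : ∃ D : Matrix (Fin 2 ⊕ Fin k) (Fin 2 ⊕ Fin k) ℂ, D = fromBlocks 1 0 0 U :=
    ⟨_, rfl⟩
  obtain ⟨W, hW⟩ : ∃ W : Matrix (Fin 2 ⊕ Fin k) (Fin (2 + k)) ℂ, W = D * V := ⟨_, rfl⟩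
  have hWW : W * Wᴴ = 1 := by
    have hUU : U * Uᴴ = 1 := mul_eq_one_comm.1 hU
    rw [hW, conjTranspose_mul, Matrix.mul_assoc, ← Matrix.mul_assoc V, hV, Matrix.one_mul, hD,
      fromBlocks_conjTranspose, fromBlocks_multiply]
    simp [hUU]
  have hWM : W * M * Wᵀ =
      fromBlocks !![0, (c : ℂ); -c, 0] 0 0 (U * (V * M * Vᵀ).toBlocks₂₂ * Uᵀ) := by
    have h : W * M * Wᵀ = D * (V * M * Vᵀ) * Dᵀ := by
      simp only [hW, transpose_mul, Matrix.mul_assoc]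
    rw [h, hblock, hD, fromBlocks_transpose, fromBlocks_multiply, fromBlocks_multiply]
    simp
  let e : Fin (2 + k) ≃ Fin 2 ⊕ Fin k := finSumFinEquiv.symm
  refine ⟨W.submatrix e id, fun j => if j = 0 then c else l (j - 1), ?_, ?_, ?_⟩
  · rw [mul_eq_one_comm, conjTranspose_submatrix]
    refine (submatrix_mul_equiv W Wᴴ e (Equiv.refl _) e).trans ?_
    simp [hWW]
  · intro j
    dsimp only
    split_ifs
    exacts [hc, hl _]
  · intro i j
    have h : W.submatrix e id * M * (W.submatrix e id)ᵀ = (W * M * Wᵀ).submatrix e e := rfl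
    rw [h, hWM]
    obtain ⟨i, rfl⟩ := finSumFinEquiv.surjective i
    obtain ⟨j, rfl⟩ := finSumFinEquiv.surjective j
    simp only [submatrix_apply, e, Equiv.symm_apply_apply]
    rcases i with i | i <;> rcases j with j | j
    · fin_cases i <;> fin_cases j <;> simp
    · have hi : (finSumFinEquiv (Sum.inl i : Fin 2 ⊕ Fin k)).val = i := by simp
      have hj : (finSumFinEquiv (Sum.inr j : Fin 2 ⊕ Fin k)).val = 2 + j := by simp
      rw [fromBlocks_apply₁₂, Matrix.zero_apply, if_neg (by omega), if_neg (by omega)]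
    · have hj : (finSumFinEquiv (Sum.inl j : Fin 2 ⊕ Fin k)).val = j := by simp
      have hi : (finSumFinEquiv (Sum.inr i : Fin 2 ⊕ Fin k)).val = 2 + i := by simp
      rw [fromBlocks_apply₂₁, Matrix.zero_apply, if_neg (by omega), if_neg (by omega)]
    · have hdiv : ∀ m : ℕ, (2 + m) / 2 = m / 2 + 1 := by omega
      have hsucc : ∀ a b : ℕ, 2 + a = 2 + b + 1 ↔ a = b + 1 := by omega
      simp only [fromBlocks_apply₂₂, hUl, finSumFinEquiv_apply_right, Fin.val_natAdd, hdiv, hsucc,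
        Nat.add_mod_left]
      simp
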